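/- Let τ be a complex number with nonzero imaginary part, and let L = {m + nτ : m, n ∈ ℤ} be the lattice generated by 1 and τ, regarded as an additive subgroup of ℂ. Let v be a nonzero complex number, and suppose there do NOT exist integers m, n (not both zero) and a real number s with v = s·(m + nτ). Then the image of the line {t·v : t ∈ ℝ} under the quotient map ℂ → ℂ/L is dense in the quotient group ℂ/L (endowed with the quotient topology). (This expresses that a trajectory on the torus whose direction is not a real multiple of any lattice vector is recurrent: its closure on the torus is the whole torus, in particular of positive measure.) -/

import Mathlib

/-- The lattice `{m + nτ : m, n ∈ ℤ}` generated by `1` and `τ`, as an additive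
subgroup of `ℂ`. -/
noncomputable def lattice (τ : ℂ) : AddSubgroup ℂ where
  carrier := {z : ℂ | ∃ m n : ℤ, z = (m : ℂ) + (n : ℂ) * τ}
  zero_mem' := ⟨0, 0, by simp⟩
  add_mem' := by
    rintro x y ⟨m, n, rfl⟩ ⟨m', n', rfl⟩
    exact ⟨m + m', n + n', by push_cast; ring⟩
  neg_mem' := by
    rintro x ⟨m, n, rfl⟩
    exact ⟨-m, -n, by push_cast; ring⟩

/-- The real-linear functional with kernel the line spanned by `v`. -/
noncomputable def crossF (v : ℂ) : ℂ →ₗ[ℝ] ℝ :=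
  v.re • Complex.imLm - v.im • Complex.reLm

theorem crossF_apply (v z : ℂ) : crossF v z = v.re * z.im - v.im * z.re := by
  simp [crossF]

theorem normSq_ne (v : ℂ) (hv : v ≠ 0) : v.re * v.re + v.im * v.im ≠ 0 := by
  have := Complex.normSq_eq_zero.not.mpr hv
  rwa [Complex.normSq_apply] at this

theorem crossF_surj (v : ℂ) (hv : v ≠ 0) : Function.Surjective (crossF v) := by
  have h := normSq_ne v hv
  intro c
  refine ⟨⟨-(c * v.im / (v.re * v.re + v.im * v.im)), c * v.re / (v.re * v.re + v.im * v.im)⟩, ?_⟩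
  rw [crossF_apply]
  have e : v.re * (c * v.re / (v.re * v.re + v.im * v.im))
      - v.im * (-(c * v.im / (v.re * v.re + v.im * v.im)))
      = c * (v.re * v.re + v.im * v.im) / (v.re * v.re + v.im * v.im) := by ring
  exact e.trans (mul_div_cancel_right₀ c h)

theorem crossF_ker (v : ℂ) (hv : v ≠ 0) (z : ℂ) (hz : crossF v z = 0) :
    ∃ t : ℝ, z = (t : ℂ) * v := by
  have h := normSq_ne v hv
  rw [crossF_apply] at hz
  refine ⟨(z.re * v.re + z.im * v.im) / (v.re * v.re + v.im * v.im), ?_⟩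
  apply Complex.ext
  · rw [Complex.re_ofReal_mul, div_mul_eq_mul_div, eq_div_iff h]
    linear_combination (-v.im) * hz
  · rw [Complex.im_ofReal_mul, div_mul_eq_mul_div, eq_div_iff h]
    linear_combination (v.re) * hz

theorem lat_cross_ne (τ : ℂ) (hτ : τ.im ≠ 0) (v : ℂ) (hv : v ≠ 0)
    (hirr : ¬ ∃ m n : ℤ, ¬(m = 0 ∧ n = 0) ∧
      ∃ s : ℝ, v = (s : ℂ) * ((m : ℂ) + (n : ℂ) * τ)) (m n : ℤ)
    (h : crossF v ((m : ℂ) + (n : ℂ) * τ) = 0) : m = 0 ∧ n = 0 := by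
  by_contra hmn
  obtain ⟨t, ht⟩ := crossF_ker v hv _ h
  have ht0 : t ≠ 0 := by
    rintro rfl
    apply hmn
    have him := congrArg Complex.im ht
    have hre := congrArg Complex.re ht
    simp [hτ] at him hre
    subst him
    simpa using hre
  refine hirr ⟨m, n, hmn, t⁻¹, ?_⟩
  have : (t : ℂ) ≠ 0 := by exact_mod_cast ht0
  rw [ht]
  push_cast
  field_simp

theorem crossF_lat (v τ : ℂ) (m n : ℤ) :
    crossF v ((m : ℂ) + (n : ℂ) * τ) = m * crossF v 1 + n * crossF v τ := by
  simp [crossF_apply]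
  ring

/-- The image on the torus `ℂ/L` of a line through the origin whose direction `v` is not
a real multiple of any nonzero lattice vector is dense in the torus (a recurrent
trajectory). -/
theorem nonlattice_direction_line_image_dense (τ : ℂ) (hτ : τ.im ≠ 0)
    (v : ℂ) (hv : v ≠ 0)
    (hirr : ¬ ∃ m n : ℤ, ¬(m = 0 ∧ n = 0) ∧
      ∃ s : ℝ, v = (s : ℂ) * ((m : ℂ) + (n : ℂ) * τ)) :
    Dense ((QuotientAddGroup.mk : ℂ → ℂ ⧸ lattice τ) ''
      {z : ℂ | ∃ t : ℝ, z = (t : ℂ) * v}) := by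
  have key := lat_cross_ne τ hτ v hv hirr
  have hb : crossF v 1 ≠ 0 := by
    intro h
    have := key 1 0 (by rw [crossF_lat, h]; simp)
    simp at this
  have hI : Irrational (crossF v τ / crossF v 1) := by
    rintro ⟨q, hq⟩
    rw [eq_div_iff hb, Rat.cast_def] at hq
    have hd : (q.den : ℝ) ≠ 0 := by exact_mod_cast q.den_nz
    have := key (-q.num) q.den (by
      rw [crossF_lat, ← hq]
      push_cast
      field_simp
      ring)
    exact q.den_nz (by exact_mod_cast this.2)
  have hD := (dense_addSubgroupClosure_pair_iff.mpr hI).preimage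
    (LinearMap.isOpenMap_of_finiteDimensional (crossF v) (crossF_surj v hv))
  rw [← QuotientAddGroup.dense_preimage_mk]
  refine hD.mono ?_
  intro z hz
  obtain ⟨n, m, h⟩ := AddSubgroup.mem_closure_pair.mp hz
  obtain ⟨t, ht⟩ := crossF_ker v hv (z - ((m : ℂ) + (n : ℂ) * τ)) (by
    rw [map_sub, crossF_lat, ← h]
    simp only [zsmul_eq_mul]
    ring)
  refine ⟨t * v, ⟨t, rfl⟩, ?_⟩
  rw [QuotientAddGroup.eq]
  exact ⟨m, n, by rw [← ht]; ring⟩
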